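/- arXiv:2502.12569 — 5 statements merged into one kernel-verified Lean document; each statement's English description precedes it below -/
import Mathlib

section
/- Suppose the strength graph is a DAG, n ≥ 1, and p : {1,…,n} → ℕ is injective. Define indices recursively: i_1 is the unique maximizer of p on {1,…,n}; if i_j < n, then i_{j+1} is the unique maximizer of p on {i_j+1, …, n}; let k be the index with i_k = n. Then the maximum of V_p(σ) over all seedings σ equals (i_1 − 1)·p(i_1) + Σ_{j=2}^{k} (i_j − i_{j−1})·p(i_j). -/
open Finset

noncomputable section
open scoped Classical

variable {P : Type*}

/-- The list of (winner, loser) pairs of the matches played in a Challenge the Champ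
tournament whose current champ is `c` and whose remaining challengers, in order, are
the given list. -/
def ctcMatches (beats : P → P → Prop) : P → List P → List (P × P)
  | _, [] => []
  | c, x :: xs =>
    if beats c x then (c, x) :: ctcMatches beats c xs
    else (x, c) :: ctcMatches beats x xs

/-- The final champ of a Challenge the Champ tournament whose current champ is `c` and
whose remaining challengers, in order, are the given list. -/
def ctcChamp (beats : P → P → Prop) : P → List P → P
  | c, [] => c
  | c, x :: xs => if beats c x then ctcChamp beats c xs else ctcChamp beats x xs

/-- The (winner, loser) pairs of matches of a Challenge the Champ tournament whose
seeding is given as a list of players. -/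
def ctcMatchesL (beats : P → P → Prop) : List P → List (P × P)
  | [] => []
  | c :: xs => ctcMatches beats c xs

/-- The winner of a Challenge the Champ tournament seeded by a list of players. -/
def ctcWinnerL (beats : P → P → Prop) : List P → Option P
  | [] => none
  | c :: xs => some (ctcChamp beats c xs)

/-- The (winner, loser) pairs of the matches played under the seeding `σ`. -/
def matchesOf (beats : P → P → Prop) {n : ℕ} (σ : Fin n → P) : List (P × P) :=
  ctcMatchesL beats (List.ofFn σ)

/-- The winner of the Challenge the Champ tournament under the seeding `σ`. -/
def winnerOf (beats : P → P → Prop) {n : ℕ} (σ : Fin n → P) : Option P :=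
  ctcWinnerL beats (List.ofFn σ)

/-- `M_i(σ)`: the set of players who play a match against `i` and lose it. -/
def Mset [Fintype P] (beats : P → P → Prop) {n : ℕ} (σ : Fin n → P) (i : P) : Finset P :=
  univ.filter fun j => (i, j) ∈ matchesOf beats σ

/-- `w_i(σ)`: the number of matches won by player `i`. -/
def wins [Fintype P] (beats : P → P → Prop) {n : ℕ} (σ : Fin n → P) (i : P) : ℕ :=
  (Mset beats σ i).card

/-- The player-popularity-based tournament value of a seeding: each match contributes
the popularity of its winner. -/
def Vpop [Fintype P] (beats : P → P → Prop) {n : ℕ} (σ : Fin n → P) (p : P → ℕ) : ℕ :=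
  ∑ i, p i * wins beats σ i

theorem ctcMatches_append (beats : P → P → Prop) (c : P) (xs ys : List P) :
    ctcMatches beats c (xs ++ ys) =
      ctcMatches beats c xs ++ ctcMatches beats (ctcChamp beats c xs) ys := by
  induction xs generalizing c with
  | nil => rfl
  | cons x xs ih =>
    by_cases h : beats c x <;> simp [ctcMatches, ctcChamp, h, ih]

theorem ctcChamp_append (beats : P → P → Prop) (c : P) (xs ys : List P) :
    ctcChamp beats c (xs ++ ys) = ctcChamp beats (ctcChamp beats c xs) ys := by
  induction xs generalizing c with
  | nil => rfl
  | cons x xs ih =>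
    by_cases h : beats c x <;> simp [ctcChamp, h, ih]

/-- A champ who beats all remaining challengers stays the champ. -/
theorem ctcChamp_of_forall_beats {beats : P → P → Prop} {c : P} {xs : List P}
    (h : ∀ x ∈ xs, beats c x) : ctcChamp beats c xs = c := by
  induction xs with
  | nil => rfl
  | cons x xs ih => grind [ctcChamp]

theorem ctcMatches_of_forall_beats {beats : P → P → Prop} {c : P} {xs : List P}
    (h : ∀ x ∈ xs, beats c x) : ctcMatches beats c xs = xs.map fun x => (c, x) := by
  induction xs with
  | nil => rfl
  | cons x xs ih => grind [ctcMatches]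

/-- The champ together with the losers of all matches are the participants. -/
theorem ctcChamp_cons_losers_perm (beats : P → P → Prop) (c : P) (xs : List P) :
    (ctcChamp beats c xs :: (ctcMatches beats c xs).map Prod.snd).Perm (c :: xs) := by
  induction xs generalizing c with
  | nil => simp [ctcChamp, ctcMatches]
  | cons x xs ih =>
    by_cases h : beats c x
    · simp only [ctcChamp, ctcMatches, h, if_true, List.map_cons]
      exact (List.Perm.swap _ _ _).trans (((ih c).cons x).trans (List.Perm.swap _ _ _))
    · simp only [ctcChamp, ctcMatches, h, if_false, List.map_cons]
      exact (List.Perm.swap _ _ _).trans ((ih x).cons c)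

theorem nodup_ctcMatchesL (beats : P → P → Prop) {l : List P} (hl : l.Nodup) :
    (ctcMatchesL beats l).Nodup := by
  cases l with
  | nil => simp [ctcMatchesL]
  | cons c xs =>
    exact ((ctcChamp_cons_losers_perm beats c xs).nodup_iff.mpr hl).of_cons.of_map _

theorem Vpop_eq_sum_matches [Fintype P] (beats : P → P → Prop) {n : ℕ} {σ : Fin n → P}
    (hσ : Function.Injective σ) (p : P → ℕ) :
    Vpop beats σ p = ((matchesOf beats σ).map fun m => p m.1).sum := by
  have hnd : (matchesOf beats σ).Nodup :=
    nodup_ctcMatchesL beats (List.nodup_ofFn.mpr hσ)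
  rw [← List.sum_toFinset _ hnd, ← Finset.filter_univ_mem (List.toFinset _),
    Finset.sum_filter, Fintype.sum_prod_type]
  refine Finset.sum_congr rfl fun i _ => ?_
  simp [wins, Mset, Finset.sum_ite, mul_comm]

/-- If every match is worth at most `g` of its loser, then the total value is at most the
total of `g` over all participants. -/
theorem sum_ctcMatches_le {beats : P → P → Prop} {p g : P → ℕ}
    (hwin : ∀ x y, beats x y → p x ≤ g y) (hlose : ∀ x y, x ≠ y → ¬ beats x y → p y ≤ g x)
    (c : P) (xs : List P) (hnd : (c :: xs).Nodup) :
    ((ctcMatches beats c xs).map fun m => p m.1).sum ≤ ((c :: xs).map g).sum := by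
  induction xs generalizing c with
  | nil => simp [ctcMatches]
  | cons x xs ih =>
    by_cases h : beats c x
    · have := ih c (by grind)
      have := hwin c x h
      simp only [ctcMatches, h, if_true, List.map_cons, List.sum_cons] at *
      omega
    · have := ih x (by grind)
      have := hlose c x (by grind) h
      simp only [ctcMatches, h, if_false, List.map_cons, List.sum_cons] at *
      omega

/-- A duplicate-free list of all elements of `Fin n` is the value list of a permutation. -/
theorem exists_perm_ofFn_eq {n : ℕ} {l : List (Fin n)} (hnd : l.Nodup) (hmem : ∀ x, x ∈ l) :
    ∃ σ : Equiv.Perm (Fin n), List.ofFn σ = l := by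
  have hlen : l.length = n := by
    simpa using Fintype.card_congr (hnd.getEquivOfForallMemList l hmem)
  refine ⟨(finCongr hlen.symm).trans (hnd.getEquivOfForallMemList l hmem), ?_⟩
  apply List.ext_get <;> simp [hlen]

/-- The best popularity among the players stronger than `x`. -/
def bestAbove {n : ℕ} (p : Fin n → ℕ) (x : Fin n) : ℕ := (Ioi x).sup p

theorem le_bestAbove {n : ℕ} (p : Fin n → ℕ) {x y : Fin n} (h : x < y) :
    p y ≤ bestAbove p x :=
  Finset.le_sup (f := p) (mem_Ioi.mpr h)

theorem bestAbove_eq {n : ℕ} {p : Fin n → ℕ} {x y : Fin n} (h : x < y)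
    (hmax : ∀ z, x < z → p z ≤ p y) : bestAbove p x = p y :=
  le_antisymm (Finset.sup_le fun z hz => hmax z (mem_Ioi.mp hz)) (le_bestAbove p h)

/-- The value of the matches lost by the players below `I j` when each loses to the most
popular stronger player. -/
def stagedValue {n : ℕ} (p : Fin n → ℕ) (I : ℕ → Fin n) (j : ℕ) : ℕ :=
  (I 0 : ℕ) * p (I 0) + ∑ i ∈ Finset.Ico 1 (j + 1), ((I i : ℕ) - (I (i - 1) : ℕ)) * p (I i)

theorem stagedValue_succ {n : ℕ} (p : Fin n → ℕ) (I : ℕ → Fin n) (j : ℕ) :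
    stagedValue p I (j + 1) =
      stagedValue p I j + ((I (j + 1) : ℕ) - (I j : ℕ)) * p (I (j + 1)) := by
  rw [stagedValue, stagedValue, Finset.sum_Ico_succ_top (by omega), add_assoc,
    Nat.add_sub_cancel]

theorem sum_Iio_bestAbove {n : ℕ} {p : Fin n → ℕ} {k : ℕ} {I : ℕ → Fin n}
    (h0 : ∀ x : Fin n, x ≠ I 0 → p x < p (I 0))
    (hstep : ∀ j, j + 1 < k →
      I j < I (j + 1) ∧ ∀ x : Fin n, I j < x → x ≠ I (j + 1) → p x < p (I (j + 1)))
    (j : ℕ) (hj : j < k) : ∑ x ∈ Iio (I j), bestAbove p x = stagedValue p I j := by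
  induction j with
  | zero =>
    have h : ∀ x ∈ Iio (I 0), bestAbove p x = p (I 0) := fun x hx =>
      bestAbove_eq (mem_Iio.mp hx) fun z _ => by grind
    simp [Finset.sum_congr rfl h, stagedValue]
  | succ j ih =>
    obtain ⟨hlt, hmax⟩ := hstep j hj
    have h : ∀ x ∈ Ico (I j) (I (j + 1)), bestAbove p x = p (I (j + 1)) := fun x hx =>
      bestAbove_eq (mem_Ico.mp hx).2 fun z hz => by grind
    have hsplit : Iio (I (j + 1)) = Iio (I j) ∪ Ico (I j) (I (j + 1)) := by
      ext x; simp only [mem_Iio, mem_union, mem_Ico]; grind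
    have hdisj : Disjoint (Iio (I j)) (Ico (I j) (I (j + 1))) := by
      rw [Finset.disjoint_left]; grind
    rw [hsplit, Finset.sum_union hdisj, ih (by omega), Finset.sum_congr rfl h,
      stagedValue_succ]
    simp

/-- There is a seeding of the players up to `I j` whose value is `stagedValue p I j`. -/
theorem exists_staged_seeding {n : ℕ} (p : Fin n → ℕ) {k : ℕ} {I : ℕ → Fin n}
    (hmono : ∀ j, j + 1 < k → I j < I (j + 1)) (j : ℕ) (hj : j < k) :
    ∃ l : List (Fin n), (I 0 :: l).Nodup ∧ (∀ x, x ∈ I 0 :: l ↔ x ≤ I j) ∧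
      ctcChamp (fun i j : Fin n => j < i) (I 0) l = I j ∧
      ((ctcMatches (fun i j : Fin n => j < i) (I 0) l).map fun m => p m.1).sum =
        stagedValue p I j := by
  induction j with
  | zero =>
    have hb : ∀ x ∈ (Iio (I 0)).toList, x < I 0 := by simp
    refine ⟨(Iio (I 0)).toList, ?_, ?_,
      ctcChamp_of_forall_beats (beats := fun i j : Fin n => j < i) hb, ?_⟩
    · simp [Finset.nodup_toList]
    · intro x; simp [le_iff_eq_or_lt]
    · simp [ctcMatches_of_forall_beats (beats := fun i j : Fin n => j < i) hb, stagedValue]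
  | succ j ih =>
    obtain ⟨l, hnd, hmem, hchamp, hval⟩ := ih (by omega)
    have hlt := hmono j hj
    have hb : ∀ x ∈ (Ioo (I j) (I (j + 1))).toList, x < I (j + 1) := by simp
    refine ⟨l ++ I (j + 1) :: (Ioo (I j) (I (j + 1))).toList, ?_, ?_, ?_, ?_⟩
    · rw [← List.cons_append, List.nodup_append']
      refine ⟨hnd, by simp [Finset.nodup_toList], fun x hx hx' => ?_⟩
      have := (hmem x).mp hx
      simp only [List.mem_cons, mem_toList, mem_Ioo] at hx'
      grind
    · intro x
      rw [← List.cons_append, List.mem_append, hmem]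
      simp only [List.mem_cons, mem_toList, mem_Ioo]
      grind
    · rw [ctcChamp_append, hchamp]
      simp [ctcChamp, hlt.not_gt, ctcChamp_of_forall_beats (beats := fun i j : Fin n => j < i) hb]
    · rw [ctcMatches_append, hchamp, List.map_append, List.sum_append, hval,
        stagedValue_succ]
      simp only [ctcMatches, hlt.not_gt, if_false,
        ctcMatches_of_forall_beats (beats := fun i j : Fin n => j < i) hb]
      have : (I j : ℕ) < I (j + 1) := hlt
      simp only [List.map_cons, List.map_map, Function.comp_def, List.map_const',
        List.sum_cons, List.sum_replicate, length_toList, Fin.card_Ioo, smul_eq_mul]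
      rw [show (I (j + 1) : ℕ) - I j = ((I (j + 1) : ℕ) - I j - 1) + 1 by omega]
      simp only [Nat.add_sub_cancel]
      ring

/-- Player-popularity optimum for DAG strength graphs (players `0,…,n-1`, where a
player beats all smaller-indexed players; paper player `i` is index `i-1` here).
Given an injective popularity function `p` and the recursively defined sequence of
indices `I 0, I 1, …, I (k-1)` (each the unique maximizer of `p` on the players
above the previous one, ending at the strongest player), the maximum tournament
value over all seedings equals
`I 0 * p (I 0) + ∑_{j=1}^{k-1} (I j − I (j-1)) * p (I j)`
(which is the paper's `(i_1 − 1)·p(i_1) + ∑_{j=2}^{k} (i_j − i_{j−1})·p(i_j)` in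
0-indexed form). -/
theorem ctc_dag_popularity_optimum (n : ℕ) (hn : 1 ≤ n)
    (p : Fin n → ℕ) (hp : Function.Injective p)
    (k : ℕ) (hk : 1 ≤ k) (I : ℕ → Fin n)
    (h0 : ∀ x : Fin n, x ≠ I 0 → p x < p (I 0))
    (hstep : ∀ j, j + 1 < k →
      I j < I (j + 1) ∧ ∀ x : Fin n, I j < x → x ≠ I (j + 1) → p x < p (I (j + 1)))
    (hlast : (I (k - 1) : ℕ) = n - 1) :
    IsGreatest
      (Set.range fun σ : Equiv.Perm (Fin n) => Vpop (fun i j : Fin n => j < i) (⇑σ) p)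
      ((I 0 : ℕ) * p (I 0) +
        ∑ j ∈ Finset.Ico 1 k, ((I j : ℕ) - (I (j - 1) : ℕ)) * p (I j)) := by
  obtain ⟨m, rfl⟩ : ∃ m, k = m + 1 := ⟨k - 1, by omega⟩
  rw [Nat.add_sub_cancel] at hlast
  have htop : ∀ x, x ≤ I m := fun x => Fin.le_def.mpr (by omega)
  change IsGreatest _ (stagedValue p I m)
  constructor
  · obtain ⟨l, hnd, hmem, -, hval⟩ :=
      exists_staged_seeding p (fun j hj => (hstep j hj).1) m (Nat.lt_succ_self m)
    obtain ⟨σ, hσ⟩ := exists_perm_ofFn_eq hnd fun x => (hmem x).mpr (htop x)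
    refine ⟨σ, ?_⟩
    simp only
    rw [Vpop_eq_sum_matches _ σ.injective, matchesOf, hσ]
    exact hval
  · rintro _ ⟨σ, rfl⟩
    simp only
    have hsum : ((List.ofFn σ).map (bestAbove p)).sum = stagedValue p I m := by
      rw [← sum_Iio_bestAbove h0 hstep m (Nat.lt_succ_self m), List.map_ofFn,
        List.sum_ofFn]
      simp only [Function.comp_apply]
      rw [Equiv.sum_comp σ (bestAbove p)]
      refine (Finset.sum_subset (subset_univ _) fun x _ hx => ?_).symm
      have hIoi : Ioi x = ∅ := by
        ext y
        have := htop y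
        simp only [mem_Iio] at hx
        simp only [mem_Ioi, notMem_empty, iff_false]
        grind
      simp [bestAbove, hIoi]
    rw [Vpop_eq_sum_matches _ σ.injective, matchesOf, ← hsum]
    have hnd : (List.ofFn σ).Nodup := List.nodup_ofFn.mpr σ.injective
    cases hl : List.ofFn σ with
    | nil => simp [ctcMatchesL]
    | cons c xs =>
      exact sum_ctcMatches_le (fun x y h => le_bestAbove p h)
        (fun x y hne h => le_bestAbove p (lt_of_le_of_ne (not_lt.mp h) hne)) c xs (hl ▸ hnd)
end
end

section
/- Suppose the strength graph is a DAG. Then for every seeding σ and every m ∈ {1,…,n}, the players 1, 2, …, m win at most m − 1 matches in total: Σ_{i=1}^{m} w_i(σ) ≤ m − 1. -/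
open Finset

noncomputable section
open scoped Classical

variable {P : Type*}

theorem snd_mem_of_mem_ctcMatches (beats : P → P → Prop) {c : P} {xs : List P} {q : P × P}
    (h : q ∈ ctcMatches beats c xs) : q.2 ∈ c :: xs := by
  induction xs generalizing c with
  | nil => simp [ctcMatches] at h
  | cons x xs ih =>
    rw [ctcMatches] at h
    split_ifs at h <;> rcases List.mem_cons.1 h with rfl | h
    · simp
    · have := ih h
      simp only [List.mem_cons] at this ⊢
      tauto
    · simp
    · exact List.mem_cons_of_mem _ (ih h)

/-- Without repeated players, every player loses at most one match. -/
theorem nodup_map_snd_ctcMatches (beats : P → P → Prop) {c : P} {xs : List P}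
    (h : (c :: xs).Nodup) : ((ctcMatches beats c xs).map Prod.snd).Nodup := by
  induction xs generalizing c with
  | nil => simp [ctcMatches]
  | cons x xs ih =>
    simp only [List.nodup_cons, List.mem_cons, not_or] at h
    obtain ⟨⟨hcx, hc⟩, hx, hxs⟩ := h
    rw [ctcMatches]
    split_ifs
    · rw [List.map_cons, List.nodup_cons]
      refine ⟨fun hmem => ?_, ih (List.nodup_cons.2 ⟨hc, hxs⟩)⟩
      obtain ⟨q, hq, rfl⟩ := List.mem_map.1 hmem
      rcases List.mem_cons.1 (snd_mem_of_mem_ctcMatches beats hq) with h | h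
      · exact hcx h.symm
      · exact hx h
    · rw [List.map_cons, List.nodup_cons]
      refine ⟨fun hmem => ?_, ih (List.nodup_cons.2 ⟨hx, hxs⟩)⟩
      obtain ⟨q, hq, rfl⟩ := List.mem_map.1 hmem
      rcases List.mem_cons.1 (snd_mem_of_mem_ctcMatches beats hq) with h | h
      · exact hcx h
      · exact hc h

/-- In a tournament without repeated players, the winner of every match beats the loser. -/
theorem beats_of_mem_ctcMatches {beats : P → P → Prop}
    (hbeats : ∀ i j, i ≠ j → ¬ beats i j → beats j i) {c : P} {xs : List P}
    (hnd : (c :: xs).Nodup) {q : P × P} (h : q ∈ ctcMatches beats c xs) : beats q.1 q.2 := by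
  induction xs generalizing c with
  | nil => simp [ctcMatches] at h
  | cons x xs ih =>
    simp only [List.nodup_cons, List.mem_cons, not_or] at hnd
    obtain ⟨⟨hcx, hc⟩, hx, hxs⟩ := hnd
    rw [ctcMatches] at h
    split_ifs at h with hb <;> rcases List.mem_cons.1 h with rfl | h
    · exact hb
    · exact ih (List.nodup_cons.2 ⟨hc, hxs⟩) h
    · exact hbeats _ _ hcx hb
    · exact ih (List.nodup_cons.2 ⟨hx, hxs⟩) h

theorem beats_of_mem_matchesOf {beats : P → P → Prop}
    (hbeats : ∀ i j, i ≠ j → ¬ beats i j → beats j i) {n : ℕ} {σ : Fin n → P}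
    (hσ : Function.Injective σ) {i j : P} (h : (i, j) ∈ matchesOf beats σ) : beats i j := by
  have hnd := List.nodup_ofFn.2 hσ
  rw [matchesOf] at h
  cases hl : List.ofFn σ with
  | nil => simp [hl, ctcMatchesL] at h
  | cons c xs =>
    rw [hl] at h hnd
    exact beats_of_mem_ctcMatches hbeats hnd h

theorem winner_unique_of_mem_matchesOf {beats : P → P → Prop} {n : ℕ} {σ : Fin n → P}
    (hσ : Function.Injective σ) {i i' j : P} (h : (i, j) ∈ matchesOf beats σ)
    (h' : (i', j) ∈ matchesOf beats σ) : i = i' := by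
  have hnd := List.nodup_ofFn.2 hσ
  rw [matchesOf] at h h'
  cases hl : List.ofFn σ with
  | nil => simp [hl, ctcMatchesL] at h
  | cons c xs =>
    rw [hl] at h h' hnd
    exact congrArg Prod.fst
      (List.inj_on_of_nodup_map (nodup_map_snd_ctcMatches beats hnd) h h' rfl)

/-- For a DAG strength graph (players `0,…,n-1`, a player beats all smaller-indexed
players; paper player `i` is index `i-1`), in any seeding the `m` weakest players
win at most `m − 1` matches in total. -/
theorem ctc_dag_weak_players_win_bound (n : ℕ) (σ : Equiv.Perm (Fin n))
    (m : ℕ) (hm1 : 1 ≤ m) (hmn : m ≤ n) :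
    ∑ i ∈ Finset.univ.filter (fun i : Fin n => (i : ℕ) < m),
        wins (fun i j : Fin n => j < i) (⇑σ) i ≤ m - 1 := by
  unfold wins
  rw [← Finset.card_biUnion]
  · calc _ ≤ (Finset.range (m - 1)).card := by
          refine Finset.card_le_card_of_injOn (fun j : Fin n => (j : ℕ)) ?_
            Fin.val_injective.injOn
          intro j hj
          simp only [coe_biUnion, Set.mem_iUnion, Mset, coe_filter, mem_univ, true_and,
            Set.mem_ofPred_eq, exists_prop] at hj
          obtain ⟨i, hi, hij⟩ := hj
          have hlt : j < i := beats_of_mem_matchesOf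
            (fun a b hab h => lt_of_le_of_ne (not_lt.1 h) hab) σ.injective hij
          have : (j : ℕ) < i := hlt
          simp only [coe_range, Set.mem_Iio]
          omega
      _ = m - 1 := Finset.card_range _
  · intro i _ i' _ hne
    refine Finset.disjoint_left.2 fun j hj hj' => hne ?_
    simp only [Mset, mem_filter, mem_univ, true_and] at hj hj'
    exact winner_unique_of_mem_matchesOf σ.injective hj hj'
end
end

section
/- For every tournament on n ≥ 2 players and every seeding σ, the arc set A(σ) = {(i,j) : i ∈ N, j ∈ M_i(σ)} is a spanning caterpillar arborescence of the tournament whose root is the tournament winner of σ. -/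
open Finset

noncomputable section
open scoped Classical

variable {P : Type*}

/-- `A` is a spanning caterpillar arborescence of the tournament `beats` with root
`root`: every arc goes from a player to a player it beats; `root` has no incoming
arc and every other player has exactly one; every player is reachable from `root`;
and the players with at least one outgoing arc, together with the arcs of `A`
joining them, form a directed path starting at `root`. -/
def IsSpanningCaterpillar (beats : P → P → Prop) (A : Set (P × P)) (root : P) : Prop :=
  (∀ a ∈ A, beats a.1 a.2) ∧
  (∀ i : P, (i, root) ∉ A) ∧
  (∀ j : P, j ≠ root → ∃! i : P, (i, j) ∈ A) ∧
  (∀ j : P, Relation.ReflTransGen (fun x y => (x, y) ∈ A) root j) ∧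
  ∃ (t : ℕ) (b : Fin t → P),
    Function.Injective b ∧
    (∀ x : P, (∃ j, (x, j) ∈ A) ↔ ∃ i, b i = x) ∧
    (∀ h : 0 < t, b ⟨0, h⟩ = root) ∧
    (∀ (i : ℕ) (h : i + 1 < t), (b ⟨i, Nat.lt_of_succ_lt h⟩, b ⟨i + 1, h⟩) ∈ A) ∧
    (∀ x y : P, (∃ j, (x, j) ∈ A) → (∃ j, (y, j) ∈ A) → (x, y) ∈ A →
      ∃ (i : ℕ) (h : i + 1 < t), x = b ⟨i, Nat.lt_of_succ_lt h⟩ ∧ y = b ⟨i + 1, h⟩)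

variable {beats : P → P → Prop}

theorem ctcMatches_losers_perm (c : P) (l : List P) :
    (ctcChamp beats c l :: (ctcMatches beats c l).map Prod.snd).Perm (c :: l) := by
  induction l generalizing c with
  | nil => simp [ctcChamp, ctcMatches]
  | cons x xs ih =>
    by_cases h : beats c x
    · simp only [ctcChamp, ctcMatches, if_pos h, List.map_cons]
      exact (List.Perm.swap _ _ _).trans (((ih c).cons x).trans (List.Perm.swap _ _ _))
    · simp only [ctcChamp, ctcMatches, if_neg h, List.map_cons]
      exact (List.Perm.swap _ _ _).trans ((ih x).cons c)

theorem mem_of_mem_ctcMatches {c i j : P} {l : List P} (h : (i, j) ∈ ctcMatches beats c l) :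
    j ∈ c :: l :=
  (ctcMatches_losers_perm c l).subset
    (List.mem_cons_of_mem _ (List.mem_map_of_mem (f := Prod.snd) h))

theorem beats_of_mem_ctcMatches_s7
    (htot : ∀ i j : P, i ≠ j → (beats i j ↔ ¬ beats j i)) (c : P) (l : List P)
    (hl : (c :: l).Nodup) {a : P × P} (ha : a ∈ ctcMatches beats c l) : beats a.1 a.2 := by
  induction l generalizing c with
  | nil => simp [ctcMatches] at ha
  | cons x xs ih =>
    simp only [List.nodup_cons, List.mem_cons, not_or] at hl
    obtain ⟨⟨hcx, hc⟩, hx, hxs⟩ := hl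
    by_cases h : beats c x
    · simp only [ctcMatches, if_pos h, List.mem_cons] at ha
      rcases ha with rfl | ha
      · exact h
      · exact ih c (List.nodup_cons.2 ⟨hc, hxs⟩) ha
    · simp only [ctcMatches, if_neg h, List.mem_cons] at ha
      rcases ha with rfl | ha
      · exact (htot x c (Ne.symm hcx)).2 h
      · exact ih x (List.nodup_cons.2 ⟨hx, hxs⟩) ha

theorem ctcChamp_reaches (c : P) (l : List P) {j : P} (hj : j ∈ c :: l) :
    Relation.ReflTransGen (fun x y => (x, y) ∈ ctcMatches beats c l)
      (ctcChamp beats c l) j := by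
  induction l generalizing c j with
  | nil =>
    obtain rfl : j = c := by simpa using hj
    exact .refl
  | cons x xs ih =>
    by_cases h : beats c x
    · simp only [ctcChamp, ctcMatches, if_pos h, List.mem_cons] at hj ⊢
      have lift {k : P} (hk : k ∈ c :: xs) :
          Relation.ReflTransGen (fun y z => (y, z) = (c, x) ∨ (y, z) ∈ ctcMatches beats c xs)
            (ctcChamp beats c xs) k :=
        Relation.ReflTransGen.mono (fun _ _ => Or.inr) _ _ (ih c hk)
      rcases hj with rfl | rfl | hj
      · exact lift (by simp)
      · exact (lift (by simp)).tail (Or.inl rfl)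
      · exact lift (by simp [hj])
    · simp only [ctcChamp, ctcMatches, if_neg h, List.mem_cons] at hj ⊢
      have lift {k : P} (hk : k ∈ x :: xs) :
          Relation.ReflTransGen (fun y z => (y, z) = (x, c) ∨ (y, z) ∈ ctcMatches beats x xs)
            (ctcChamp beats x xs) k :=
        Relation.ReflTransGen.mono (fun _ _ => Or.inr) _ _ (ih x hk)
      rcases hj with rfl | hj
      · exact (lift (by simp)).tail (Or.inl rfl)
      · exact lift (by simpa using hj)

/-- The successive champs of a Challenge the Champ tournament with current champ `c`,
listed from the final champ back to `c`. -/
def ctcChamps (beats : P → P → Prop) : P → List P → List P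
  | c, [] => [c]
  | c, x :: xs => if beats c x then ctcChamps beats c xs else ctcChamps beats x xs ++ [c]

theorem head?_ctcChamps (c : P) (l : List P) :
    (ctcChamps beats c l).head? = some (ctcChamp beats c l) := by
  induction l generalizing c with
  | nil => rfl
  | cons x xs ih => by_cases h : beats c x <;> simp [ctcChamps, ctcChamp, h, ih]

theorem exists_ctcChamps_eq_concat (c : P) (l : List P) :
    ∃ l', ctcChamps beats c l = l' ++ [c] := by
  induction l generalizing c with
  | nil => exact ⟨[], rfl⟩
  | cons x xs ih => by_cases h : beats c x <;> simp [ctcChamps, h, ih]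

theorem ctcChamps_subset (c : P) (l : List P) : ctcChamps beats c l ⊆ c :: l := by
  induction l generalizing c with
  | nil => simp [ctcChamps]
  | cons x xs ih =>
    intro y hy
    by_cases h : beats c x
    · have := @ih c y
      simp_all [ctcChamps]
      tauto
    · have := @ih x y
      simp_all [ctcChamps]
      tauto

theorem nodup_ctcChamps (c : P) (l : List P) (hl : (c :: l).Nodup) :
    (ctcChamps beats c l).Nodup := by
  induction l generalizing c with
  | nil => simp [ctcChamps]
  | cons x xs ih =>
    by_cases h : beats c x
    · simp only [ctcChamps, if_pos h]
      exact ih c (by simp_all)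
    · simp only [ctcChamps, if_neg h]
      refine List.nodup_append.2 ⟨ih x (by simp_all), by simp, ?_⟩
      rintro a ha b hb rfl
      obtain rfl : a = c := by simpa using hb
      exact (List.nodup_cons.1 hl).1 (ctcChamps_subset x xs ha)

theorem isChain_ctcChamps (c : P) (l : List P) :
    (ctcChamps beats c l).IsChain (fun x y => (x, y) ∈ ctcMatches beats c l) := by
  induction l generalizing c with
  | nil => simp [ctcChamps]
  | cons x xs ih =>
    by_cases h : beats c x
    · simp only [ctcChamps, ctcMatches, if_pos h]
      exact (ih c).imp fun _ _ => List.mem_cons_of_mem _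
    · simp only [ctcChamps, ctcMatches, if_neg h]
      obtain ⟨l', hl'⟩ := exists_ctcChamps_eq_concat (beats := beats) x xs
      refine List.IsChain.append ((ih x).imp fun _ _ => List.mem_cons_of_mem _) (by simp) ?_
      simp [hl']

theorem winner_mem_ctcChamps {c i j : P} {l : List P} (h : (i, j) ∈ ctcMatches beats c l) :
    i ∈ ctcChamps beats c l := by
  induction l generalizing c with
  | nil => simp [ctcMatches] at h
  | cons x xs ih =>
    by_cases hb : beats c x
    · simp only [ctcChamps, ctcMatches, if_pos hb, List.mem_cons, Prod.mk.injEq] at h ⊢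
      obtain ⟨l', hl'⟩ := exists_ctcChamps_eq_concat (beats := beats) c xs
      rcases h with ⟨rfl, -⟩ | h
      · simp [hl']
      · exact ih h
    · simp only [ctcChamps, ctcMatches, if_neg hb, List.mem_cons, Prod.mk.injEq,
        List.mem_append] at h ⊢
      obtain ⟨l', hl'⟩ := exists_ctcChamps_eq_concat (beats := beats) x xs
      rcases h with ⟨rfl, -⟩ | h
      · simp [hl']
      · exact Or.inl (ih h)

theorem exists_win_of_mem_ctcChamps {c i : P} {l : List P} (h : i ∈ ctcChamps beats c l)
    (hi : i ≠ c) : ∃ j, (i, j) ∈ ctcMatches beats c l := by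
  induction l generalizing c with
  | nil => simp_all [ctcChamps]
  | cons x xs ih =>
    by_cases hb : beats c x
    · simp only [ctcChamps, ctcMatches, if_pos hb] at h ⊢
      obtain ⟨j, hj⟩ := ih h hi
      exact ⟨j, List.mem_cons_of_mem _ hj⟩
    · simp only [ctcChamps, ctcMatches, if_neg hb, List.mem_append, List.mem_singleton, hi,
        or_false] at h ⊢
      by_cases hx : i = x
      · exact ⟨c, by simp [hx]⟩
      · obtain ⟨j, hj⟩ := ih h hx
        exact ⟨j, List.mem_cons_of_mem _ hj⟩

theorem pair_isInfix_ctcChamps {c i j : P} {l : List P} (hl : (c :: l).Nodup)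
    (h : (i, j) ∈ ctcMatches beats c l) (hj : j ∈ ctcChamps beats c l) :
    [i, j] <:+: ctcChamps beats c l := by
  induction l generalizing c with
  | nil => simp [ctcMatches] at h
  | cons x xs ih =>
    by_cases hb : beats c x
    · simp only [ctcChamps, ctcMatches, if_pos hb, List.mem_cons, Prod.mk.injEq] at h hj ⊢
      rcases h with ⟨-, rfl⟩ | h
      · have := ctcChamps_subset _ _ hj
        simp_all
      · exact ih (by simp_all) h hj
    · simp only [ctcChamps, ctcMatches, if_neg hb, List.mem_cons, Prod.mk.injEq] at h hj ⊢
      rcases h with ⟨rfl, rfl⟩ | h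
      · obtain ⟨l', hl'⟩ := exists_ctcChamps_eq_concat (beats := beats) i xs
        exact ⟨l', [], by simp [hl']⟩
      · have hne : j ≠ c := by
          rintro rfl
          exact (List.nodup_cons.1 hl).1 (mem_of_mem_ctcMatches h)
        have hj' : j ∈ ctcChamps beats x xs := by simpa [hne] using hj
        exact (ih (List.nodup_cons.1 hl).2 h hj').trans (List.prefix_append _ _).isInfix

theorem ctcMatches_cons_winners_path {v u : P} {l : List P} (hl : (v :: l).Nodup)
    (hu : u ∉ v :: l) :
    ∃ (t : ℕ) (b : Fin t → P),
      Function.Injective b ∧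
      (∀ x : P, (∃ j, (x, j) ∈ (v, u) :: ctcMatches beats v l) ↔ ∃ i, b i = x) ∧
      (∀ h : 0 < t, b ⟨0, h⟩ = ctcChamp beats v l) ∧
      (∀ (i : ℕ) (h : i + 1 < t), (b ⟨i, Nat.lt_of_succ_lt h⟩, b ⟨i + 1, h⟩) ∈
        (v, u) :: ctcMatches beats v l) ∧
      (∀ x y : P, (∃ j, (x, j) ∈ (v, u) :: ctcMatches beats v l) →
        (∃ j, (y, j) ∈ (v, u) :: ctcMatches beats v l) →
        (x, y) ∈ (v, u) :: ctcMatches beats v l →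
        ∃ (i : ℕ) (h : i + 1 < t), x = b ⟨i, Nat.lt_of_succ_lt h⟩ ∧ y = b ⟨i + 1, h⟩) := by
  have winners (x : P) : (∃ j, (x, j) ∈ (v, u) :: ctcMatches beats v l) ↔
      x ∈ ctcChamps beats v l := by
    constructor
    · rintro ⟨j, hj⟩
      rcases List.mem_cons.1 hj with hj | hj
      · obtain ⟨l', hl'⟩ := exists_ctcChamps_eq_concat (beats := beats) v l
        simp_all
      · exact winner_mem_ctcChamps hj
    · intro hx
      by_cases hxv : x = v
      · exact ⟨u, by simp [hxv]⟩
      · obtain ⟨j, hj⟩ := exists_win_of_mem_ctcChamps hx hxv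
        exact ⟨j, List.mem_cons_of_mem _ hj⟩
  refine ⟨(ctcChamps beats v l).length, (ctcChamps beats v l).get,
    List.nodup_iff_injective_get.1 (nodup_ctcChamps v l hl), ?_, ?_, ?_, ?_⟩
  · intro x
    rw [winners, List.mem_iff_get]
  · intro h
    have := head?_ctcChamps (beats := beats) v l
    rw [List.head?_eq_getElem?, List.getElem?_eq_getElem h] at this
    exact Option.some.inj this
  · intro i h
    exact List.mem_cons_of_mem _ (List.isChain_iff_getElem.1 (isChain_ctcChamps v l) i h)
  · intro x y _ hy hxy
    rw [winners] at hy
    rcases List.mem_cons.1 hxy with hxy | hxy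
    · obtain rfl : y = u := congrArg Prod.snd hxy
      exact absurd (ctcChamps_subset v l hy) hu
    · obtain ⟨l₁, l₂, h⟩ := pair_isInfix_ctcChamps hl hxy hy
      refine ⟨l₁.length, by simp [← h], ?_, ?_⟩ <;> simp [← h]

/-- For any tournament on `n ≥ 2` players and any seeding, the set of
(winner, loser) pairs of the matches played is a spanning caterpillar arborescence
of the tournament whose root is the tournament winner. -/
theorem ctc_matches_spanning_caterpillar {P : Type*} [Fintype P]
    (hn : 2 ≤ Fintype.card P)
    (beats : P → P → Prop)
    (hirr : ∀ i, ¬ beats i i)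
    (htot : ∀ i j : P, i ≠ j → (beats i j ↔ ¬ beats j i))
    (σ : Fin (Fintype.card P) ≃ P) (w : P)
    (hw : winnerOf beats (⇑σ) = some w) :
    IsSpanningCaterpillar beats {m : P × P | m ∈ matchesOf beats (⇑σ)} w := by
  have hl : (List.ofFn σ).Nodup := List.nodup_ofFn.2 σ.injective
  have hmem (j : P) : j ∈ List.ofFn σ := by simp [List.mem_ofFn, σ.surjective j]
  have hlen : (List.ofFn σ).length = Fintype.card P := List.length_ofFn
  unfold matchesOf
  unfold winnerOf at hw
  generalize List.ofFn σ = l at *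
  match l, hlen with
  | [], hlen => simp at hlen; omega
  | [_], hlen => simp at hlen; omega
  | c :: x :: xs, _ =>
  obtain rfl : ctcChamp beats c (x :: xs) = w := by simpa [ctcWinnerL] using hw
  have hperm := ctcMatches_losers_perm (beats := beats) c (x :: xs)
  have hnodup := hperm.nodup_iff.2 hl
  rw [List.nodup_cons] at hnodup
  refine ⟨fun a ha => beats_of_mem_ctcMatches_s7 htot c _ hl ha, ?_, ?_,
    fun j => ctcChamp_reaches c _ (hmem j), ?_⟩
  · intro i hi
    exact hnodup.1 (List.mem_map_of_mem (f := Prod.snd) hi)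
  · intro j hj
    have hj' := hperm.symm.subset (hmem j)
    rw [List.mem_cons, or_iff_right hj, List.mem_map] at hj'
    obtain ⟨⟨i, k⟩, hi, rfl⟩ := hj'
    exact ⟨i, hi, fun i' hi' =>
      congrArg Prod.fst (List.inj_on_of_nodup_map hnodup.2 hi' hi rfl)⟩
  · simp only [Set.mem_ofPred_eq, ctcMatchesL]
    by_cases h : beats c x
    · simp only [ctcMatches, ctcChamp, if_pos h]
      exact ctcMatches_cons_winners_path (hl.sublist (by simp))
        (List.nodup_cons.1 ((List.Perm.swap x c xs).nodup_iff.1 hl)).1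
    · simp only [ctcMatches, ctcChamp, if_neg h]
      exact ctcMatches_cons_winners_path (List.nodup_cons.1 hl).2 (List.nodup_cons.1 hl).1
end
end

section
/- For every tournament on n ≥ 2 players and every spanning caterpillar arborescence A of the tournament, there exists a seeding σ such that A(σ) = A, where A(σ) = {(i,j) : i ∈ N, j ∈ M_i(σ)} is the set of (winner, loser) pairs of the matches played under σ. -/
open Finset

noncomputable section
open scoped Classical

variable {P : Type*}

/-- Some match of the tournament is lost by each player other than the final champ. -/
lemma eq_ctcChamp_or_exists_mem_ctcMatches (beats : P → P → Prop) (l : List P) :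
    ∀ c x : P, x ∈ c :: l → x = ctcChamp beats c l ∨ ∃ w, (w, x) ∈ ctcMatches beats c l := by
  induction l with
  | nil => simp [ctcChamp]
  | cons y l ih =>
    intro c x hx
    by_cases h : beats c y
    · have := ih c x
      simp only [ctcChamp, ctcMatches, h, if_true, List.mem_cons, Prod.mk.injEq] at this hx ⊢
      grind
    · have := ih y x
      simp only [ctcChamp, ctcMatches, h, if_false, List.mem_cons, Prod.mk.injEq] at this hx ⊢
      grind

lemma ctcMatches_append_of_forall_beats (beats : P → P → Prop) (c : P) (l r : List P)
    (h : ∀ x ∈ l, beats c x) :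
    ctcMatches beats c (l ++ r) = l.map (c, ·) ++ ctcMatches beats c r := by
  induction l with
  | nil => simp
  | cons y l ih => simp_all [ctcMatches]

/-- If each champ of a chain first beats the challengers listed by `lv` and then loses to the
next member of the chain, then every match played is an arc of `A`. -/
lemma mem_of_mem_ctcMatches_flatMap (beats : P → P → Prop) (A : Set (P × P))
    (hbeats : ∀ a ∈ A, beats a.1 a.2) (hasymm : ∀ i j, beats i j → ¬ beats j i)
    (lv : P → List P) (hlv : ∀ x, ∀ y ∈ lv x, (x, y) ∈ A) (cs : List P) :
    ∀ c : P, List.IsChain (fun x y => (y, x) ∈ A) (c :: cs) →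
      ∀ m ∈ ctcMatches beats c (lv c ++ cs.flatMap fun x => x :: lv x), m ∈ A := by
  induction cs with
  | nil =>
    intro c _ m hm
    rw [ctcMatches_append_of_forall_beats _ _ _ _ fun y hy => hbeats _ (hlv c y hy)] at hm
    simp only [List.flatMap_nil, ctcMatches, List.append_nil, List.mem_map] at hm
    obtain ⟨y, hy, rfl⟩ := hm
    exact hlv c y hy
  | cons d cs ih =>
    intro c hc m hm
    rw [List.isChain_cons_cons] at hc
    rw [ctcMatches_append_of_forall_beats _ _ _ _ fun y hy => hbeats _ (hlv c y hy),
      List.flatMap_cons, List.cons_append, ctcMatches, if_neg (hasymm _ _ (hbeats _ hc.1))] at hm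
    simp only [List.mem_append, List.mem_map, List.mem_cons] at hm
    obtain ⟨y, hy, rfl⟩ | rfl | hm := hm
    · exact hlv c y hy
    · exact hc.1
    · exact ih d hc.2 m hm

/-- A duplicate-free list of all elements of a type is a bijective enumeration of the type. -/
lemma exists_equiv_ofFn_eq [Fintype P] (l : List P) (hl : l.Nodup) (hmem : ∀ x, x ∈ l) :
    ∃ σ : Fin (Fintype.card P) ≃ P, List.ofFn (⇑σ) = l := by
  have hcard : Fintype.card P = l.length := by
    simpa using Fintype.card_congr (hl.getEquivOfForallMemList l hmem).symm
  refine ⟨(finCongr hcard).trans (hl.getEquivOfForallMemList l hmem), ?_⟩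
  apply List.ext_get <;> simp [hcard]

/-- For any tournament on `n ≥ 2` players and any spanning caterpillar arborescence
`A` of the tournament, there is a seeding whose set of (winner, loser) pairs of
matches played is exactly `A`. -/
theorem spanning_caterpillar_realizable {P : Type*} [Fintype P]
    (hn : 2 ≤ Fintype.card P)
    (beats : P → P → Prop)
    (hirr : ∀ i, ¬ beats i i)
    (htot : ∀ i j : P, i ≠ j → (beats i j ↔ ¬ beats j i))
    (A : Set (P × P)) (root : P)
    (hA : IsSpanningCaterpillar beats A root) :
    ∃ σ : Fin (Fintype.card P) ≃ P,
      {m : P × P | m ∈ matchesOf beats (⇑σ)} = A := by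
  obtain ⟨hbeats, hroot, hpar, hreach, t, b, hinj, hb, -, hchain, -⟩ := hA
  have hasymm : ∀ i j, beats i j → ¬ beats j i := fun i j h =>
    (htot i j fun e => hirr j (e ▸ h)).1 h
  have huniq : ∀ i k j, (i, j) ∈ A → (k, j) ∈ A → i = k := fun i k j hi hk =>
    (hpar j fun e => hroot i (e ▸ hi)).unique hi hk
  have hrootout : ∃ j, (root, j) ∈ A := by
    have : Nontrivial P := Fintype.one_lt_card_iff_nontrivial.1 hn
    obtain ⟨j, hj⟩ := exists_ne root
    obtain h | ⟨k, hk, -⟩ := (hreach j).cases_head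
    · exact absurd h.symm hj
    · exact ⟨k, hk⟩
  set lv : P → List P := fun x => (univ.filter fun y => (x, y) ∈ A ∧ ¬ ∃ z, (y, z) ∈ A).toList
  have mem_lv : ∀ x y, y ∈ lv x ↔ (x, y) ∈ A ∧ ¬ ∃ z, (y, z) ∈ A := by simp [lv]
  have hlv : ∀ x, ∀ y ∈ lv x, (x, y) ∈ A := fun x y hy => ((mem_lv x y).1 hy).1
  obtain ⟨cs, hcs⟩ : ∃ cs, cs = (List.ofFn b).reverse := ⟨_, rfl⟩
  have mem_cs : ∀ x, x ∈ cs ↔ ∃ j, (x, j) ∈ A := by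
    simp [hcs, hb]
  have cs_nodup : cs.Nodup := by
    simpa [hcs, List.nodup_ofFn] using hinj
  have cs_chain : List.IsChain (fun x y => (y, x) ∈ A) cs := by
    rw [hcs, List.isChain_reverse, List.isChain_iff_getElem]
    intro i hi
    simpa using hchain i (by simpa using hi)
  have seed_nodup : (cs.flatMap fun x => x :: lv x).Nodup := by
    rw [List.nodup_flatMap]
    refine ⟨fun x _ => List.nodup_cons.2 ⟨fun hx => hirr x (hbeats _ (hlv x x hx)),
      Finset.nodup_toList _⟩, cs_nodup.imp_of_mem fun {x y} hx hy hxy z hzx hzy => ?_⟩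
    rw [mem_cs] at hx hy
    rw [List.mem_cons, mem_lv] at hzx hzy
    grind
  have mem_seed : ∀ x, x ∈ cs.flatMap fun x => x :: lv x := by
    intro x
    rw [List.mem_flatMap]
    by_cases hx : ∃ j, (x, j) ∈ A
    · exact ⟨x, (mem_cs x).2 hx, List.mem_cons_self⟩
    · obtain ⟨i, hi, -⟩ := hpar x fun e => hx (e ▸ hrootout)
      exact ⟨i, (mem_cs i).2 ⟨x, hi⟩, List.mem_cons_of_mem _ ((mem_lv i x).2 ⟨hi, hx⟩)⟩
  obtain ⟨σ, hσ⟩ := exists_equiv_ofFn_eq _ seed_nodup mem_seed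
  refine ⟨σ, ?_⟩
  rw [matchesOf, hσ]
  cases cs with
  | nil => simpa using (mem_cs root).2 hrootout
  | cons c cs =>
    have hsub := mem_of_mem_ctcMatches_flatMap beats A hbeats hasymm lv hlv cs c cs_chain
    have hlose := eq_ctcChamp_or_exists_mem_ctcMatches beats
      (lv c ++ cs.flatMap fun x => x :: lv x) c
    have hchamp := (hlose root (mem_seed root)).resolve_right
      fun ⟨w, hw⟩ => hroot w (hsub _ hw)
    refine Set.Subset.antisymm hsub fun ⟨i, j⟩ hij => ?_
    obtain h | ⟨w, hw⟩ := hlose j (mem_seed j)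
    · exact absurd (h.trans hchamp.symm ▸ hij) (hroot i)
    · exact huniq w i j (hsub _ hw) hij ▸ hw
end
end

section
/- Let (N, beats) be a tournament on n players and let p : N → ℕ have image {v_1, v_2, …, v_k} with v_1 > v_2 > … > v_k = 0 and k ≥ 2. For i ∈ {1,…,k−1} define p_i : N → ℕ by p_i(x) = v_i if p(x) = v_i and p_i(x) = 0 otherwise. Then max_{1≤i≤k−1} ( max over seedings σ of V_{p_i}(σ) ) ≥ (1/(k−1)) · ( max over seedings σ of V_p(σ) ). -/
open Finset

noncomputable section
open scoped Classical

variable {P : Type*}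

/-- Approximation guarantee for the greedy algorithm: if the popularity function
`p` has image `{v 1 > v 2 > … > v k = 0}` with `k ≥ 2`, and `p_i` keeps only the
players of popularity `v i` (setting all others to 0), then the largest of the
optimal values for `p_1, …, p_(k-1)` is at least `1/(k-1)` times the optimal value
for `p` (stated multiplicatively: `OPT ≤ (k-1) · max_i OPT_i`). -/
theorem ctc_popularity_greedy_approximation {P : Type*} [Fintype P]
    (beats : P → P → Prop)
    (hirr : ∀ i, ¬ beats i i)
    (htot : ∀ i j : P, i ≠ j → (beats i j ↔ ¬ beats j i))
    (p : P → ℕ) (k : ℕ) (hk : 2 ≤ k) (v : ℕ → ℕ)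
    (hdec : ∀ i, 1 ≤ i → i + 1 ≤ k → v (i + 1) < v i)
    (hvk : v k = 0)
    (himg1 : ∀ x : P, ∃ i, 1 ≤ i ∧ i ≤ k ∧ p x = v i)
    (himg2 : ∀ i, 1 ≤ i → i ≤ k → ∃ x : P, p x = v i)
    (M : ℕ) (Mi : ℕ → ℕ)
    (hM : IsGreatest (Set.range fun σ : Fin (Fintype.card P) ≃ P => Vpop beats (⇑σ) p) M)
    (hMi : ∀ i, 1 ≤ i → i ≤ k - 1 →
      IsGreatest
        (Set.range fun σ : Fin (Fintype.card P) ≃ P =>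
          Vpop beats (⇑σ) fun x => if p x = v i then v i else 0)
        (Mi i)) :
    M ≤ (k - 1) * (Finset.Icc 1 (k - 1)).sup Mi := by
  obtain ⟨⟨σ, rfl⟩, -⟩ := hM
  have hle : ∀ x, p x ≤ ∑ i ∈ Finset.Icc 1 (k - 1), if p x = v i then v i else 0 := by
    intro x
    obtain ⟨i, h1, h2, hx⟩ := himg1 x
    rcases Nat.eq_or_lt_of_le h2 with rfl | hlt
    · simp [hx, hvk]
    · refine le_trans ?_ (Finset.single_le_sum
        (f := fun i => if p x = v i then v i else 0) (fun _ _ => Nat.zero_le _)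
        (Finset.mem_Icc.mpr ⟨h1, Nat.le_sub_one_of_lt hlt⟩))
      simp [hx]
  calc Vpop beats (⇑σ) p
      ≤ ∑ x, (∑ i ∈ Finset.Icc 1 (k - 1), if p x = v i then v i else 0) * wins beats (⇑σ) x :=
        Finset.sum_le_sum fun x _ => Nat.mul_le_mul_right _ (hle x)
    _ = ∑ i ∈ Finset.Icc 1 (k - 1), Vpop beats (⇑σ) fun x => if p x = v i then v i else 0 := by
        simp only [Vpop, Finset.sum_mul]
        exact Finset.sum_comm
    _ ≤ ∑ _i ∈ Finset.Icc 1 (k - 1), (Finset.Icc 1 (k - 1)).sup Mi := by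
        refine Finset.sum_le_sum fun i hi => ?_
        obtain ⟨h1, h2⟩ := Finset.mem_Icc.mp hi
        exact ((hMi i h1 h2).2 ⟨σ, rfl⟩).trans (Finset.le_sup hi)
    _ = (k - 1) * (Finset.Icc 1 (k - 1)).sup Mi := by simp
end
end
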